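/- arXiv:2108.12021 — 2 statements merged into one kernel-verified Lean document; each statement's English description precedes it below -/
import Mathlib

section
/- Let B be an affine k-domain with a nontrivial fundamental pair (D,U), induced ℤ-grading B = ⊕_{i∈ℤ} B_i, A = ker D, A_i = A ∩ B_i, 𝓕_n = ker D^{n+1} and I_n = D^n(𝓕_n). Then for every n ≥ 0, I_n = ⊕_{i ≥ n} A_i. In particular, A = ⊕_{i∈ℕ} A_i is ℕ-graded, and an element of A lies in I_n if and only if all of its homogeneous components of degree less than n vanish. -/
/-- A derivation is locally nilpotent if every element is annihilated by some power. -/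
def IsLND {R B : Type*} [CommRing R] [CommRing B] [Algebra R B]
    (D : Derivation R B B) : Prop :=
  ∀ b : B, ∃ n : ℕ, (D.toLinearMap ^ n) b = 0

/-- The degree-`d` piece `B_d = ker([D,U] - d·id)` of the `ℤ`-grading induced by `(D, U)`. -/
def gradePiece {R B : Type*} [CommRing R] [CommRing B] [Algebra R B]
    (D U : Derivation R B B) (d : ℤ) : Submodule R B :=
  LinearMap.ker ((⁅D, U⁆ : Derivation R B B).toLinearMap
    - d • (LinearMap.id : B →ₗ[R] B))

/-- `(D, U)` is a fundamental pair: both are locally nilpotent, `[D,[D,U]] = -2D`,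
`[U,[D,U]] = 2U`, and `B` is the sum of the eigenspaces of `[D,U]`. -/
def IsFundamentalPair {R B : Type*} [CommRing R] [CommRing B] [Algebra R B]
    (D U : Derivation R B B) : Prop :=
  IsLND D ∧ IsLND U ∧
    ⁅D, ⁅D, U⁆⁆ = (-2 : ℤ) • D ∧
    ⁅U, ⁅D, U⁆⁆ = (2 : ℤ) • U ∧
    (⨆ d : ℤ, gradePiece D U d) = ⊤

section FundamentalPair

variable {k B : Type*} [CommRing k] [CommRing B] [Algebra k B] {D U : Derivation k B B}

theorem mem_gradePiece_iff {d : ℤ} {b : B} :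
    b ∈ gradePiece D U d ↔ D (U b) = U (D b) + d • b := by
  simp only [gradePiece, LinearMap.mem_ker, LinearMap.sub_apply, LinearMap.smul_apply,
    LinearMap.id_apply, Derivation.coeFn_coe, Derivation.commutator_apply]
  rw [sub_sub, sub_eq_zero]

theorem gradePiece_eq_eigenspace (d : ℤ) :
    gradePiece D U d = Module.End.eigenspace (⁅D, U⁆ : Derivation k B B).toLinearMap (d : k) := by
  ext b
  rw [Module.End.mem_eigenspace_iff, Int.cast_smul_eq_zsmul, gradePiece, LinearMap.mem_ker,
    LinearMap.sub_apply, sub_eq_zero]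
  rfl

theorem iSupIndep_gradePiece [IsDomain k] [CharZero k] [Module.IsTorsionFree k B]
    (D U : Derivation k B B) : iSupIndep (gradePiece D U) := by
  rw [show gradePiece D U = _ from funext gradePiece_eq_eigenspace]
  exact (Module.End.eigenspaces_iSupIndep _).comp Int.cast_injective

theorem IsFundamentalPair.map_mem (h : IsFundamentalPair D U) {d : ℤ} {b : B}
    (hb : b ∈ gradePiece D U d) : D b ∈ gradePiece D U (d + 2) := by
  have hH := DFunLike.congr_fun h.2.2.1 b
  simp only [Derivation.commutator_apply, Derivation.smul_apply] at hH
  rw [mem_gradePiece_iff] at hb ⊢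
  have hD := congrArg D hb
  rw [map_add, map_zsmul] at hD
  simp only [map_sub, zsmul_eq_mul] at *
  push_cast at *
  linear_combination hD - hH

theorem IsFundamentalPair.map_mem' (h : IsFundamentalPair D U) {d : ℤ} {b : B}
    (hb : b ∈ gradePiece D U d) : U b ∈ gradePiece D U (d - 2) := by
  have hH := DFunLike.congr_fun h.2.2.2.1 b
  simp only [Derivation.commutator_apply, Derivation.smul_apply] at hH
  rw [mem_gradePiece_iff] at hb ⊢
  have hU := congrArg U hb
  rw [map_add, map_zsmul] at hU
  simp only [map_sub, zsmul_eq_mul] at *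
  push_cast at *
  linear_combination hU - hH

theorem IsFundamentalPair.pow_map_mem (h : IsFundamentalPair D U) {d : ℤ} {b : B}
    (hb : b ∈ gradePiece D U d) (n : ℕ) :
    (D.toLinearMap ^ n) b ∈ gradePiece D U (d + 2 * n) := by
  induction n with
  | zero => simpa using hb
  | succ n ih =>
    rw [pow_succ', Module.End.mul_apply]
    have := h.map_mem ih
    rwa [show d + 2 * (n : ℤ) + 2 = d + 2 * (n + 1 : ℕ) by push_cast; ring] at this

theorem IsFundamentalPair.pow_map_mem' (h : IsFundamentalPair D U) {d : ℤ} {b : B}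
    (hb : b ∈ gradePiece D U d) (n : ℕ) :
    (U.toLinearMap ^ n) b ∈ gradePiece D U (d - 2 * n) := by
  induction n with
  | zero => simpa using hb
  | succ n ih =>
    rw [pow_succ', Module.End.mul_apply]
    have := h.map_mem' ih
    rwa [show d - 2 * (n : ℤ) - 2 = d - 2 * (n + 1 : ℕ) by push_cast; ring] at this

/-- The `sl₂` relation `[Eⁿ⁺¹, F] = (n + 1) Eⁿ (H + n)` on a vector of weight `d`. -/
theorem IsFundamentalPair.pow_succ_map (h : IsFundamentalPair D U) {d : ℤ} {b : B}
    (hb : b ∈ gradePiece D U d) (n : ℕ) :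
    (D.toLinearMap ^ (n + 1)) (U b) =
      U ((D.toLinearMap ^ (n + 1)) b) + ((n + 1) * (d + n)) • (D.toLinearMap ^ n) b := by
  induction n with
  | zero => simpa using mem_gradePiece_iff.1 hb
  | succ n ih =>
    have hw := mem_gradePiece_iff.1 (h.pow_map_mem hb (n + 1))
    rw [pow_succ' _ (n + 1), Module.End.mul_apply, Module.End.mul_apply, ih, map_add, map_zsmul,
      ← Module.End.mul_apply _ (D.toLinearMap ^ n), ← pow_succ']
    simp only [Derivation.coeFn_coe] at hw ⊢
    rw [hw]
    simp only [zsmul_eq_mul]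
    push_cast
    ring

/-- A vector of weight `d` killed by `Dⁿ⁺¹` vanishes if `d < -n`. -/
theorem IsFundamentalPair.eq_zero_of_pow_succ_eq_zero [Module.IsTorsionFree ℤ B]
    (h : IsFundamentalPair D U) {d : ℤ} {b : B} (hb : b ∈ gradePiece D U d) {n : ℕ}
    (hn : (D.toLinearMap ^ (n + 1)) b = 0) (hd : d + n < 0) : b = 0 := by
  obtain ⟨N, hN⟩ := h.2.1 b
  induction N generalizing d b n with
  | zero => simpa using hN
  | succ N ih =>
    have hUb : U b = 0 := by
      refine ih (h.map_mem' hb) (n := n + 1) ?_ (by push_cast; linarith) ?_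
      · rw [h.pow_succ_map hb (n + 1), hn, pow_succ', Module.End.mul_apply, hn]
        simp
      · rwa [pow_succ, Module.End.mul_apply] at hN
    have key : ∀ j ≤ n + 1, (D.toLinearMap ^ j) b = 0 → b = 0 := by
      intro j
      induction j with
      | zero => intro _ hj; simpa using hj
      | succ j ihj =>
        intro hjn hj
        refine ihj (by omega) ?_
        have e := h.pow_succ_map hb j
        rw [hUb, hj, map_zero, map_zero, zero_add, eq_comm, smul_eq_zero] at e
        refine e.resolve_left (mul_ne_zero (by omega) (by omega))
    exact key _ le_rfl hn

/-- On a highest weight vector of weight `d ≥ n`, `Dⁿ Uⁿ` is a nonzero scalar. -/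
theorem IsFundamentalPair.exists_pow_pow_eq_zsmul (h : IsFundamentalPair D U) {d : ℤ} {a : B}
    (ha : a ∈ gradePiece D U d) (hDa : D a = 0) {n : ℕ} (hn : n ≤ d) :
    ∃ c : ℤ, c ≠ 0 ∧ (D.toLinearMap ^ n) ((U.toLinearMap ^ n) a) = c • a := by
  induction n with
  | zero => exact ⟨1, one_ne_zero, by simp⟩
  | succ n ih =>
    push_cast at hn
    obtain ⟨c, hc, e⟩ := ih (by omega)
    refine ⟨(n + 1) * (d - n) * c, mul_ne_zero (mul_ne_zero (by omega) (by omega)) hc, ?_⟩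
    have hz : (D.toLinearMap ^ (n + 1)) ((U.toLinearMap ^ n) a) = 0 := by
      rw [pow_succ', Module.End.mul_apply, e, map_zsmul, show D.toLinearMap a = 0 from hDa,
        smul_zero]
    rw [pow_succ' U.toLinearMap, Module.End.mul_apply]
    refine (h.pow_succ_map (h.pow_map_mem' ha n) n).trans ?_
    rw [hz, map_zero, zero_add, e, smul_smul]
    congr 1
    ring

end FundamentalPair

theorem IsFundamentalPair.ker_inf_range_pow {k B : Type*} [Field k] [CharZero k] [CommRing B]
    [Algebra k B] {D U : Derivation k B B} (h : IsFundamentalPair D U) (n : ℕ) :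
    LinearMap.ker D.toLinearMap ⊓ LinearMap.range (D.toLinearMap ^ n)
      = ⨆ i : ℤ, ⨆ _ : (n : ℤ) ≤ i, (LinearMap.ker D.toLinearMap ⊓ gradePiece D U i) := by
  have : Module.IsTorsionFree ℤ B := .trans_faithfulSMul ℤ k B
  apply le_antisymm
  · rintro _ ⟨hDa, b, rfl⟩
    obtain ⟨f, hf, hfb⟩ := (Submodule.mem_iSup_iff_exists_finsupp (gradePiece D U) b).1
      (h.2.2.2.2 ▸ Submodule.mem_top)
    have hker : ∀ i ∈ f.support, (D.toLinearMap ^ (n + 1)) (f i) = 0 := by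
      refine (iSupIndep_iff_finsetSum_eq_zero_imp_eq_zero _).1
        ((iSupIndep_gradePiece D U).comp (add_left_injective (2 * ((n + 1 : ℕ) : ℤ)))) f.support
        (fun i => (D.toLinearMap ^ (n + 1)) (f i)) (fun i _ => h.pow_map_mem (hf i) (n + 1)) ?_
      rw [← map_sum, pow_succ', Module.End.mul_apply]
      change D.toLinearMap ((D.toLinearMap ^ n) (f.sum fun _ x => x)) = 0
      rw [hfb]
      exact hDa
    rw [← hfb, Finsupp.sum, map_sum]
    refine Submodule.sum_mem _ fun i hi => ?_
    by_cases hin : i + n < 0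
    · rw [h.eq_zero_of_pow_succ_eq_zero (hf i) (hker i hi) hin, map_zero]
      exact Submodule.zero_mem _
    · refine Submodule.mem_iSup_of_mem (i + 2 * n) (Submodule.mem_iSup_of_mem (by omega) ?_)
      refine ⟨?_, h.pow_map_mem (hf i) n⟩
      have := hker i hi
      rwa [pow_succ', Module.End.mul_apply] at this
  · refine iSup₂_le fun i hi => ?_
    rintro a ⟨hDa, ha⟩
    refine ⟨hDa, ?_⟩
    obtain ⟨c, hc, e⟩ := h.exists_pow_pow_eq_zsmul ha hDa hi
    refine ⟨(c : k)⁻¹ • (U.toLinearMap ^ n) a, ?_⟩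
    rw [map_smul, e, ← Int.cast_smul_eq_zsmul k, inv_smul_smul₀ (Int.cast_ne_zero.2 hc)]

/-- for a nontrivial fundamental pair `(D,U)` on an affine `k`-domain `B`,
the image ideals satisfy `I_n = A ∩ D^n(B) = ⊕_{i ≥ n} A_i`, where `A_i = A ∩ B_i`;
in particular `A = ker D = ⊕_{i ∈ ℕ} A_i` is `ℕ`-graded. -/
theorem stmt_6 {k B : Type*} [Field k] [CharZero k] [CommRing B] [IsDomain B] [Algebra k B]
    [Algebra.FiniteType k B]
    (D U : Derivation k B B) (hDU : IsFundamentalPair D U) (hnt : ¬(D = 0 ∧ U = 0)) :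
    (∀ n : ℕ,
      LinearMap.ker D.toLinearMap ⊓ LinearMap.range (D.toLinearMap ^ n)
        = ⨆ i : ℤ, ⨆ _ : (n : ℤ) ≤ i, (LinearMap.ker D.toLinearMap ⊓ gradePiece D U i)) ∧
    LinearMap.ker D.toLinearMap
        = ⨆ i : ℕ, (LinearMap.ker D.toLinearMap ⊓ gradePiece D U (i : ℤ)) := by
  refine ⟨hDU.ker_inf_range_pow, ?_⟩
  have h0 := hDU.ker_inf_range_pow 0
  rw [pow_zero, show LinearMap.range (1 : Module.End k B) = ⊤ from LinearMap.range_id,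
    inf_top_eq] at h0
  refine h0.trans (le_antisymm (iSup₂_le fun i hi => ?_) (iSup_le fun i => ?_))
  · lift i to ℕ using hi
    exact le_iSup (fun i : ℕ => LinearMap.ker D.toLinearMap ⊓ gradePiece D U (i : ℤ)) i
  · exact le_iSup₂_of_le (i : ℤ) (Int.natCast_nonneg i) le_rfl
end

section
/- Let B be an affine k-domain with dim_k B ≥ 2 carrying a nontrivial fundamental pair (D,U), with A = ker D, A_0 = A ∩ ker U, and plinth ideal I_1 = A ∩ D(B). Then A = A_0 ⊕ I_1 as A_0-modules (so A_0 is a retract of A), and I_1 is a prime ideal of A. -/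
section FundamentalPair

variable {R B : Type*} [CommRing R] [CommRing B] [Algebra R B] {D U : Derivation R B B}

theorem mem_gradePiece {d : ℤ} {b : B} : b ∈ gradePiece D U d ↔ ⁅D, U⁆ b = d • b :=
  sub_eq_zero (a := ⁅D, U⁆ b)

theorem map_mem_gradePiece_add_two (h : ⁅D, ⁅D, U⁆⁆ = (-2 : ℤ) • D) {d : ℤ} {b : B}
    (hb : b ∈ gradePiece D U d) : D b ∈ gradePiece D U (d + 2) := by
  rw [mem_gradePiece] at hb ⊢
  have h₁ := DFunLike.congr_fun h b
  rw [Derivation.commutator_apply, hb, map_zsmul, Derivation.smul_apply] at h₁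
  rw [add_smul]
  linear_combination (exp := 1) -h₁

theorem map_mem_gradePiece_sub_two (h : ⁅U, ⁅D, U⁆⁆ = (2 : ℤ) • U) {d : ℤ} {b : B}
    (hb : b ∈ gradePiece D U d) : U b ∈ gradePiece D U (d - 2) := by
  rw [mem_gradePiece] at hb ⊢
  have h₁ := DFunLike.congr_fun h b
  rw [Derivation.commutator_apply, hb, map_zsmul, Derivation.smul_apply] at h₁
  rw [sub_smul]
  linear_combination (exp := 1) -h₁

theorem apply_apply_eq_add {d : ℤ} {b : B} (hb : b ∈ gradePiece D U d) :
    D (U b) = U (D b) + d • b := by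
  rw [← mem_gradePiece.1 hb, Derivation.commutator_apply]
  abel

theorem pow_mem_gradePiece (h : ⁅U, ⁅D, U⁆⁆ = (2 : ℤ) • U) {d : ℤ} {b : B}
    (hb : b ∈ gradePiece D U d) (n : ℕ) :
    (U.toLinearMap ^ n) b ∈ gradePiece D U (d - 2 * n) := by
  induction n with
  | zero => simpa using hb
  | succ n ih =>
    rw [pow_succ', Module.End.mul_apply]
    have h₁ : d - 2 * ((n + 1 : ℕ) : ℤ) = d - 2 * n - 2 := by
      push_cast
      ring
    exact h₁ ▸ map_mem_gradePiece_sub_two h ih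

theorem apply_apply_pow (h : ⁅U, ⁅D, U⁆⁆ = (2 : ℤ) • U) {d : ℤ} {b : B}
    (hb : b ∈ gradePiece D U d) (hUD : U (D b) = 0) (n : ℕ) :
    U (D ((U.toLinearMap ^ n) b)) = (n * (d - n + 1) : ℤ) • (U.toLinearMap ^ n) b := by
  induction n with
  | zero => simpa using hUD
  | succ n ih =>
    rw [pow_succ', Module.End.mul_apply]
    change U (D (U ((U.toLinearMap ^ n) b))) = _ • U ((U.toLinearMap ^ n) b)
    rw [
      apply_apply_eq_add (pow_mem_gradePiece h hb n), ih,
      ← add_smul, map_zsmul]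
    congr 1
    push_cast
    ring

/-- A vector of negative weight killed by `U ∘ D` vanishes. -/
theorem eq_zero_of_mem_gradePiece_neg [IsAddTorsionFree B] (hU : IsLND U)
    (h : ⁅U, ⁅D, U⁆⁆ = (2 : ℤ) • U) {d : ℤ} (hd : d < 0) {b : B}
    (hb : b ∈ gradePiece D U d) (hUD : U (D b) = 0) : b = 0 := by
  obtain ⟨n, hn⟩ := hU b
  induction n with
  | zero => simpa using hn
  | succ n ih =>
    apply ih
    have h₁ := apply_apply_eq_add (pow_mem_gradePiece h hb n)
    rw [pow_succ', Module.End.mul_apply] at hn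
    rw [apply_apply_pow h hb hUD, ← add_smul] at h₁
    have h₂ : U ((U.toLinearMap ^ n) b) = 0 := hn
    rw [h₂, map_zero, eq_comm, smul_eq_zero] at h₁
    refine h₁.resolve_left fun h₃ => ?_
    nlinarith [mul_nonneg (Int.natCast_nonneg n) (Int.natCast_nonneg n),
      mul_nonneg (Int.natCast_nonneg n) (neg_nonneg.2 hd.le)]

end FundamentalPair

section Field

variable {k B : Type*} [Field k] [CharZero k] [CommRing B] [Algebra k B]
  {D U : Derivation k B B}

theorem iSupIndep_gradePiece_s10 : iSupIndep (gradePiece D U) := by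
  have h := (Module.End.eigenspaces_iSupIndep (⁅D, U⁆ : Derivation k B B).toLinearMap).comp
    (Int.cast_injective (α := k))
  convert h using 1
  ext d b
  rw [mem_gradePiece, Function.comp_apply, Module.End.mem_eigenspace_iff,
    Int.cast_smul_eq_zsmul]
  rfl

/-- Linear independence of the graded pieces. -/
theorem eq_zero_of_sum_eq_zero {s : Finset ℤ} {c : ℤ} {g : ℤ → B}
    (hg : ∀ d, g d ∈ gradePiece D U (d + c)) (hs : ∑ d ∈ s, g d = 0) : ∀ d ∈ s, g d = 0 :=
  (iSupIndep_iff_finsetSum_eq_zero_imp_eq_zero _).1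
    (iSupIndep_gradePiece_s10.comp (add_left_injective c)) s g (fun d _ => hg d) hs

end Field

/-- for a nontrivial fundamental pair `(D,U)` on an affine `k`-domain `B`
of dimension at least 2, with `A = ker D`, `A_0 = A ∩ ker U` and plinth ideal
`I_1 = A ∩ D(B)`: `A = A_0 ⊕ I_1` (so `A_0` is a retract of `A`), and `I_1` is a prime
ideal of `A`. -/
theorem stmt_10 {k B : Type*} [Field k] [CharZero k] [CommRing B] [IsDomain B] [Algebra k B]
    [Algebra.FiniteType k B] (hdim : 2 ≤ ringKrullDim B)
    (D U : Derivation k B B) (hDU : IsFundamentalPair D U) (hnt : ¬(D = 0 ∧ U = 0)) :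
    ((LinearMap.ker D.toLinearMap ⊓ LinearMap.ker U.toLinearMap) ⊓
        (LinearMap.ker D.toLinearMap ⊓ LinearMap.range D.toLinearMap) = ⊥) ∧
    ((LinearMap.ker D.toLinearMap ⊓ LinearMap.ker U.toLinearMap) ⊔
        (LinearMap.ker D.toLinearMap ⊓ LinearMap.range D.toLinearMap)
          = LinearMap.ker D.toLinearMap) ∧
    ((1 : B) ∉ Set.range ⇑D) ∧
    (∀ a b : B, D a = 0 → D b = 0 → a * b ∈ Set.range ⇑D →
      a ∈ Set.range ⇑D ∨ b ∈ Set.range ⇑D) := by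
  obtain ⟨-, hU, hE, hF, htop⟩ := hDU
  have : CharZero B := charZero_of_injective_algebraMap (algebraMap k B).injective
  have hdec (b : B) : ∃ f : ℤ →₀ B, (∀ d, f d ∈ gradePiece D U d) ∧ ∑ d ∈ f.support, f d = b :=
    (Submodule.mem_iSup_iff_exists_finsupp _ _).1 (htop ▸ Submodule.mem_top)
  have hinf (a : B) (hDa : D a = 0) (hUa : U a = 0) (ha : a ∈ Set.range D) : a = 0 := by
    obtain ⟨b, rfl⟩ := ha
    obtain ⟨f, hf, rfl⟩ := hdec b
    set a := D (∑ d ∈ f.support, f d) with ha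
    have ha₀ : a ∈ gradePiece D U (-2 + 2) := by
      rw [mem_gradePiece, Derivation.commutator_apply, hDa, hUa]
      simp
    have hs : ∑ d ∈ insert (-2) f.support, (D (f d) - if d = -2 then a else 0) = 0 := by
      rw [Finset.sum_sub_distrib, Finset.sum_ite_eq' _ (-2 : ℤ),
        if_pos (Finset.mem_insert_self _ _), sub_eq_zero, ha, map_sum]
      symm
      apply Finset.sum_subset (Finset.subset_insert _ _)
      intro d _ hd
      rw [Finsupp.notMem_support_iff.1 hd, map_zero]
    have h₀ := eq_zero_of_sum_eq_zero (D := D) (U := U) (c := 2) (fun d => by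
      refine Submodule.sub_mem _ (map_mem_gradePiece_add_two hE (hf d)) ?_
      split_ifs with hd
      · exact hd ▸ ha₀
      · exact Submodule.zero_mem _) hs (-2) (Finset.mem_insert_self _ _)
    rw [if_pos rfl, sub_eq_zero] at h₀
    rw [← h₀, eq_zero_of_mem_gradePiece_neg hU hF (by norm_num) (hf (-2)) (by rw [h₀, hUa]),
      map_zero]
  have hsup (a : B) (hDa : D a = 0) :
      a ∈ (LinearMap.ker D.toLinearMap ⊓ LinearMap.ker U.toLinearMap) ⊔
      (LinearMap.ker D.toLinearMap ⊓ LinearMap.range D.toLinearMap) := by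
    obtain ⟨f, hf, rfl⟩ := hdec a
    rw [map_sum] at hDa
    have hDf := eq_zero_of_sum_eq_zero (fun d => map_mem_gradePiece_add_two hE (hf d)) hDa
    refine Submodule.sum_mem _ fun d hd => ?_
    have hDd := hDf d hd
    have hDU := apply_apply_eq_add (hf d)
    rw [hDd, map_zero, zero_add] at hDU
    rcases lt_trichotomy d 0 with hd₀ | rfl | hd₀
    · rw [eq_zero_of_mem_gradePiece_neg hU hF hd₀ (hf d) (by rw [hDd, map_zero])]
      exact Submodule.zero_mem _
    · refine Submodule.mem_sup_left ⟨hDd, ?_⟩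
      refine eq_zero_of_mem_gradePiece_neg hU hF (by norm_num)
        (map_mem_gradePiece_sub_two hF (hf 0)) ?_
      change U (D (U (f 0))) = 0
      rw [hDU, zero_smul, map_zero]
    · refine Submodule.mem_sup_right ⟨hDd, (d : k)⁻¹ • U (f d), ?_⟩
      have hdk : (d : k) ≠ 0 := Int.cast_ne_zero.2 hd₀.ne'
      rw [map_smul]
      change (d : k)⁻¹ • D (U (f d)) = f d
      rw [hDU, ← Int.cast_smul_eq_zsmul k, inv_smul_smul₀ hdk]
  refine ⟨?_, ?_, ?_, ?_⟩
  · rw [eq_bot_iff]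
    rintro a ⟨⟨hDa, hUa⟩, -, ha⟩
    exact hinf a hDa hUa ha
  · exact le_antisymm (sup_le inf_le_left inf_le_left) fun a ha => hsup a ha
  · exact fun h => one_ne_zero (hinf 1 D.map_one_eq_zero U.map_one_eq_zero h)
  · intro a b ha hb hab
    obtain ⟨a₀, ⟨hDa₀, hUa₀⟩, a₁, ⟨hDa₁, x, hx⟩, rfl⟩ := Submodule.mem_sup.1 (hsup a ha)
    obtain ⟨b₀, ⟨hDb₀, hUb₀⟩, b₁, ⟨hDb₁, y, hy⟩, rfl⟩ := Submodule.mem_sup.1 (hsup b hb)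
    obtain ⟨z, hz⟩ := hab
    change D a₀ = 0 at hDa₀
    change U a₀ = 0 at hUa₀
    change D b₀ = 0 at hDb₀
    change U b₀ = 0 at hUb₀
    change D x = a₁ at hx
    change D y = b₁ at hy
    have h₀ : a₀ * b₀ = 0 := by
      refine hinf _ (by simp [hDa₀, hDb₀]) (by simp [hUa₀, hUb₀])
        ⟨z - x * (b₀ + b₁) - a₀ * y, ?_⟩
      simp only [map_sub, Derivation.leibniz, smul_eq_mul, hz, hb, hDa₀, hx, hy]
      ring
    rcases mul_eq_zero.1 h₀ with rfl | rfl
    · exact Or.inl ⟨x, by rw [hx, zero_add]⟩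
    · exact Or.inr ⟨y, by rw [hy, zero_add]⟩
end
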